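/- Let K be a field and T a K-linear triangulated category such that for all objects A, B of T the K-vector space ⊕_{k∈ℤ} Hom_T(A, B[k]) is finite-dimensional. Let (E_0, …, E_m) be a full exceptional sequence in T, and let (E'_m, …, E'_0) be a full exceptional sequence in T such that for all 0 ≤ i, j ≤ m and all k ∈ ℤ the space Hom_T(E_i, E'_j[k]) is 1-dimensional if i = j and k = 0, and zero otherwise. Fix 0 ≤ l ≤ m, and let F be an object of T such that for all 0 ≤ i ≤ m and all k ∈ ℤ the space Hom_T(E_i, F[k]) is 1-dimensional if i = l and k = 0, and zero otherwise. Then F ≅ E'_l. -/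

import Mathlib

open CategoryTheory CategoryTheory.Limits CategoryTheory.Pretriangulated

section

variable {T : Type*} [Category T] [Preadditive T] [HasZeroObject T] [HasShift T ℤ]
  [∀ n : ℤ, (shiftFunctor T n).Additive] [Pretriangulated T]

/-- Membership in the smallest strictly full triangulated subcategory of `T`
containing a class of objects `S`. -/
inductive GenSub (S : Set T) : T → Prop
  | of (X : T) (hX : X ∈ S) : GenSub S X
  | zero (X : T) (hX : IsZero X) : GenSub S X
  | isoClosed {X Y : T} (e : X ≅ Y) (hX : GenSub S X) : GenSub S Y
  | shift (X : T) (n : ℤ) (hX : GenSub S X) : GenSub S (X⟦n⟧)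
  | ext (Tr : Triangle T) (hTr : Tr ∈ distTriang T) (h₁ : GenSub S Tr.obj₁)
      (h₂ : GenSub S Tr.obj₂) : GenSub S Tr.obj₃

end

/-- An object `E` of a `K`-linear triangulated category is exceptional if `Hom(E, E)` is
one-dimensional over `K` and `Hom(E, E⟦k⟧) = 0` for all `k ≠ 0`. -/
def IsExceptional (K : Type*) [Field K] {T : Type*} [Category T] [Preadditive T]
    [Linear K T] [HasShift T ℤ] (E : T) : Prop :=
  Module.finrank K (E ⟶ E) = 1 ∧ ∀ k : ℤ, k ≠ 0 → ∀ φ : E ⟶ E⟦k⟧, φ = 0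

section helpers

variable {T : Type*} [Category T] [Preadditive T] [HasZeroObject T] [HasShift T ℤ]
  [∀ n : ℤ, (shiftFunctor T n).Additive] [Pretriangulated T]

def Perp (A X : T) : Prop := ∀ (k : ℤ) (φ : A ⟶ X⟦k⟧), φ = 0

lemma hom_zero_of_iso {A X Y : T} (e : X ≅ Y) (h : ∀ φ : A ⟶ X, φ = 0) (φ : A ⟶ Y) : φ = 0 := by
  have := h (φ ≫ e.inv)
  rw [← cancel_mono e.inv, this, zero_comp]

lemma Perp.shift {A X : T} (h : Perp A X) (n : ℤ) : Perp A (X⟦n⟧) := fun k φ =>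
  hom_zero_of_iso ((shiftFunctorAdd' T n k (n + k) rfl).app X) (h (n + k)) φ

lemma Perp.zero {A X : T} (h : Perp A X) (φ : A ⟶ X) : φ = 0 :=
  hom_zero_of_iso ((shiftFunctorZero T ℤ).app X) (h 0) φ

lemma Perp.shift_left {A X : T} (h : Perp A X) (n : ℤ) : Perp (A⟦n⟧) X := fun k φ => by
  apply (shiftFunctor T (-n)).map_injective
  rw [Functor.map_zero]
  have := (h.shift k).shift (-n) |>.zero
    (((shiftFunctorCompIsoId T n (-n) (by simp)).app A).inv ≫ φ⟦-n⟧')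
  rw [← cancel_epi (((shiftFunctorCompIsoId T n (-n) (by simp)).app A).inv), this, comp_zero]

lemma exact3 (Tr : Triangle T) (hTr : Tr ∈ distTriang T) {A : T} (j : ℤ)
    (h : A ⟶ Tr.obj₃⟦j⟧) (h0 : h ≫ Tr.mor₃⟦j⟧' = 0) :
    ∃ g : A ⟶ Tr.obj₂⟦j⟧, h = g ≫ Tr.mor₂⟦j⟧' := by
  have hex : ∃ g : A ⟶ Tr.obj₂⟦j⟧, h = g ≫ (j.negOnePow • Tr.mor₂⟦j⟧') :=
    Triangle.coyoneda_exact₃ _ (Tr.shift_distinguished hTr j) h (by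
    change h ≫ (j.negOnePow • Tr.mor₃⟦j⟧' ≫ (shiftFunctorComm T 1 j).hom.app Tr.obj₁) = 0
    rw [Linear.comp_units_smul, ← Category.assoc, h0, zero_comp, smul_zero])
  obtain ⟨g, hg⟩ := hex
  refine ⟨j.negOnePow • g, ?_⟩
  rw [hg, Linear.comp_units_smul, Linear.units_smul_comp]

lemma Perp.tri (Tr : Triangle T) (hTr : Tr ∈ distTriang T) {A : T} (h1 : Perp A Tr.obj₁)
    (h2 : Perp A Tr.obj₂) : Perp A Tr.obj₃ := fun k φ => by
  obtain ⟨g, hg⟩ := exact3 Tr hTr k φ ((h1.shift 1) k _)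
  rw [hg, h2 k g, zero_comp]

lemma isZero_of_perp {S : Set T} (hS : ∀ X, GenSub S X) (C : T) (hC : ∀ A ∈ S, Perp A C) :
    IsZero C := by
  have key : ∀ X, GenSub S X → Perp X C := by
    intro X hX
    induction hX with
    | of X hX => exact hC X hX
    | zero X hX => exact fun k φ => hX.eq_of_src _ _
    | isoClosed e _ ih =>
      intro k φ
      rw [← cancel_epi e.hom, ih k (e.hom ≫ φ), comp_zero]
    | shift X n _ ih => exact ih.shift_left n
    | ext Tr hTr _ _ ih1 ih2 =>
      intro k φ
      obtain ⟨g, hg⟩ := Triangle.yoneda_exact₃ Tr hTr φ (ih2 k _)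
      rw [hg, ih1.shift_left 1 k g, comp_zero]
  rw [IsZero.iff_id_eq_zero]
  exact (key C (hS C)).zero _

variable {K : Type*} [Field K] [Linear K T] [∀ n : ℤ, (shiftFunctor T n).Linear K]

lemma lift3 {X Y D : T} {a : X ⟶ Y} {b : Y ⟶ D} {d : D ⟶ X⟦(1 : ℤ)⟧}
    (hTr : Triangle.mk a b d ∈ distTriang T) {A : T} (f : A ⟶ X)
    (hf : ∀ u : A ⟶ X, ∃ c : K, u = c • f)
    (h0 : ∀ k : ℤ, k ≠ 0 → ∀ u : A ⟶ X⟦k⟧, u = 0)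
    (hne : f ≫ a ≠ 0) (j : ℤ) (h : A ⟶ D⟦j⟧) :
    ∃ g : A ⟶ Y⟦j⟧, h = g ≫ b⟦j⟧' := by
  refine exact3 _ hTr j h ?_
  change h ≫ d⟦j⟧' = 0
  by_cases hj : j = -1
  · subst hj
    let e := shiftFunctorCompIsoId T (1 : ℤ) (-1) (by simp)
    obtain ⟨c, hc⟩ := hf ((h ≫ d⟦(-1 : ℤ)⟧') ≫ e.hom.app _)
    have h1 : ((h ≫ d⟦(-1 : ℤ)⟧') ≫ e.hom.app _) ≫ a = 0 := by
      have := e.hom.naturality a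
      dsimp at this
      rw [Category.assoc, ← this, Category.assoc, ← Functor.map_comp_assoc,
        show d ≫ a⟦(1 : ℤ)⟧' = 0 from comp_distTriang_mor_zero₃₁ _ hTr]
      simp
    rw [hc, Linear.smul_comp, smul_eq_zero] at h1
    have hc0 : c = 0 := h1.resolve_right hne
    rw [hc0, zero_smul] at hc
    rw [← cancel_mono (e.hom.app _), hc, zero_comp]
  · exact hom_zero_of_iso ((shiftFunctorAdd' T 1 j (1 + j) rfl).app _) (h0 (1 + j) (by omega)) _

lemma perp3 {X Y D : T} {a : X ⟶ Y} {b : Y ⟶ D} {d : D ⟶ X⟦(1 : ℤ)⟧}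
    (hTr : Triangle.mk a b d ∈ distTriang T) {A : T} (f : A ⟶ X)
    (hf : ∀ u : A ⟶ X, ∃ c : K, u = c • f)
    (h0 : ∀ k : ℤ, k ≠ 0 → ∀ u : A ⟶ X⟦k⟧, u = 0)
    (hne : f ≫ a ≠ 0)
    (hf2 : ∀ u : A ⟶ Y, ∃ c : K, u = c • (f ≫ a))
    (h02 : ∀ k : ℤ, k ≠ 0 → ∀ u : A ⟶ Y⟦k⟧, u = 0) : Perp A D := by
  intro j h
  obtain ⟨g, rfl⟩ := lift3 hTr f hf h0 hne j h
  by_cases hj : j = 0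
  · subst hj
    let e := shiftFunctorZero T ℤ
    obtain ⟨c, hc⟩ := hf2 (g ≫ e.hom.app _)
    have := e.hom.naturality b
    dsimp at this
    rw [← cancel_mono (e.hom.app _), Category.assoc, this, ← Category.assoc, hc, Linear.smul_comp,
      Category.assoc, show a ≫ b = 0 from comp_distTriang_mor_zero₁₂ _ hTr]
    simp
  · rw [h02 j hj g, zero_comp]

/-- Dimension decrease. -/
lemma dim_lt (hfin : ∀ A B : T, FiniteDimensional K (DirectSum ℤ (fun k : ℤ => A ⟶ B⟦k⟧)))
    {E C D : T} (hE : ∀ u : E ⟶ E, ∃ c : K, u = c • 𝟙 E)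
    (hE0 : ∀ k : ℤ, k ≠ 0 → ∀ u : E ⟶ E⟦k⟧, u = 0)
    (n : ℤ) (f : E ⟶ C⟦n⟧) (hf : f ≠ 0) (g : C⟦n⟧ ⟶ D) (h : D ⟶ E⟦(1 : ℤ)⟧)
    (hT : Triangle.mk f g h ∈ distTriang T) :
    Module.finrank K (DirectSum ℤ (fun k : ℤ => E ⟶ D⟦k⟧)) <
      Module.finrank K (DirectSum ℤ (fun k : ℤ => E ⟶ C⟦k⟧)) := by
  have := hfin E C
  have := hfin E D
  let σ : ℤ ≃ ℤ := (Equiv.addLeft n).symm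
  obtain ⟨a⟩ : Nonempty (∀ j : ℤ, C⟦σ.symm j⟧ ≅ C⟦n⟧⟦j⟧) :=
    ⟨fun j => (shiftFunctorAdd' T n j (n + j) rfl).app C⟩
  let L : ∀ j : ℤ, (E ⟶ C⟦σ.symm j⟧) →ₗ[K] (E ⟶ D⟦j⟧) := fun j =>
    Linear.rightComp K E ((a j).hom ≫ g⟦j⟧')
  have hL : ∀ j, Function.Surjective (L j) := by
    intro j u
    obtain ⟨v, hv⟩ := lift3 (K := K) hT (𝟙 E) hE hE0 (by simpa using hf) j u
    refine ⟨v ≫ (a j).inv, ?_⟩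
    change (v ≫ (a j).inv) ≫
      (a j).hom ≫ g⟦j⟧' = u
    rw [hv]
    simp
  have hL0 : ¬ Function.Injective (L 0) := by
    intro hinj
    apply hf
    let w : E ⟶ C⟦n⟧⟦(0 : ℤ)⟧ := f ≫ (shiftFunctorZero T ℤ).inv.app _
    have hw : w ≫ g⟦(0 : ℤ)⟧' = 0 := by
      have h1 := (shiftFunctorZero T ℤ).inv.naturality g
      have h2 : f ≫ g = 0 := comp_distTriang_mor_zero₁₂ _ hT
      dsimp at h1
      dsimp only [w]
      rw [Category.assoc, ← h1, ← Category.assoc, h2, zero_comp]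
    have h3 : L 0 (w ≫ (a 0).inv) = L 0 0 := by
      refine Eq.trans ?_ (LinearMap.map_zero (L 0)).symm
      change (w ≫ (a 0).inv) ≫
        (a 0).hom ≫ g⟦(0 : ℤ)⟧' = 0
      simpa using hw
    have h4 := hinj h3
    have h5 : w = 0 := by
      have := congrArg (· ≫ (a 0).hom) h4
      simpa only [Category.assoc, Iso.inv_hom_id, Category.comp_id, zero_comp] using this
    have := congrArg (· ≫ (shiftFunctorZero T ℤ).hom.app _) h5
    simpa [w] using this
  let Φ := (DirectSum.lmap L).comp
    (DirectSum.lequivCongrLeft K (M := fun k : ℤ => E ⟶ C⟦k⟧) σ).toLinearMap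
  have hs : Function.Surjective Φ := by
    rw [LinearMap.coe_comp]
    exact ((DirectSum.lmap_surjective L).2 hL).comp (LinearEquiv.surjective _)
  have hni : ¬ Function.Injective Φ := by
    intro hi
    rw [LinearMap.coe_comp] at hi
    exact hL0 ((DirectSum.lmap_injective L).1
      (Function.Injective.of_comp_right hi (LinearEquiv.surjective _)) 0)
  refine lt_of_le_of_ne (LinearMap.finrank_le_finrank_of_surjective hs) (fun heq => hni ?_)
  exact (LinearMap.injective_iff_surjective_of_finrank_eq_finrank heq.symm).2 hs

lemma orth (hfin : ∀ A B : T, FiniteDimensional K (DirectSum ℤ (fun k : ℤ => A ⟶ B⟦k⟧)))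
    (m : ℕ) (E : Fin (m + 1) → T)
    (hE : ∀ i, ∀ u : E i ⟶ E i, ∃ c : K, u = c • 𝟙 (E i))
    (hE0 : ∀ i, ∀ k : ℤ, k ≠ 0 → ∀ u : E i ⟶ (E i)⟦k⟧, u = 0)
    (hseq : ∀ i j : Fin (m + 1), i < j → Perp (E j) (E i))
    (hfull : ∀ X : T, GenSub (Set.range E) X) (n : ℕ) (hn : n ≤ m + 1) :
    ∀ C F : T, (∀ i : Fin (m + 1), n ≤ i.val → Perp (E i) C) →
      (∀ i : Fin (m + 1), i.val < n → Perp (E i) F) → ∀ φ : C ⟶ F, φ = 0 := by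
  induction n with
  | zero =>
    intro C F hC _ φ
    refine (isZero_of_perp hfull C ?_).eq_of_src _ _
    rintro _ ⟨i, rfl⟩
    exact hC i (Nat.zero_le _)
  | succ n ih =>
    have ih := ih (by omega)
    let i₀ : Fin (m + 1) := ⟨n, by omega⟩
    suffices H : ∀ d : ℕ, ∀ C F : T,
        Module.finrank K (DirectSum ℤ (fun k : ℤ => E i₀ ⟶ C⟦k⟧)) = d →
        (∀ i : Fin (m + 1), n + 1 ≤ i.val → Perp (E i) C) →
        (∀ i : Fin (m + 1), i.val < n + 1 → Perp (E i) F) → ∀ φ : C ⟶ F, φ = 0 from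
      fun C F => H _ C F rfl
    intro d
    induction d using Nat.strong_induction_on with
    | _ d IH =>
    intro C F hd hC hF φ
    by_cases hp : Perp (E i₀) C
    · refine ih C F (fun i hi => ?_) (fun i hi => hF i (by omega)) φ
      by_cases hi' : n + 1 ≤ i.val
      · exact hC i hi'
      · have : i = i₀ := Fin.ext (by change i.val = n; omega)
        rw [this]; exact hp
    · unfold Perp at hp
      push Not at hp
      obtain ⟨k, f, hf⟩ := hp
      obtain ⟨D, g, h, hT⟩ := distinguished_cocone_triangle f
      have hlt := dim_lt hfin (hE i₀) (hE0 i₀) k f hf g h hT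
      apply (shiftFunctor T k).map_injective
      rw [Functor.map_zero]
      obtain ⟨ψ, hψ⟩ : ∃ ψ : D ⟶ F⟦k⟧, φ⟦k⟧' = g ≫ ψ := Triangle.yoneda_exact₂ _ hT (φ⟦k⟧') ((hF i₀ (Nat.lt_succ_self n)) k _)
      rw [hψ, IH _ (hd ▸ hlt) D (F⟦k⟧) rfl (fun i hi => ?_) (fun i hi => (hF i hi).shift k) ψ,
        comp_zero]
      exact Perp.tri _ hT (hseq i₀ i (Fin.lt_def.2 hi)) ((hC i hi).shift k)

end helpers

/-- **Uniqueness in the dual exceptional sequence.** Let `(E 0, …, E m)` be a full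
exceptional sequence and `(E' m, …, E' 0)` a full exceptional sequence dual to it. If `F`
is an object such that `Hom(E i, F⟦k⟧)` is one-dimensional when `i = l` and `k = 0` and
zero otherwise, then `F ≅ E' l`. -/
theorem iso_dual_of_hom_conditions
    {K : Type*} [Field K] {T : Type*} [Category T] [Preadditive T] [Linear K T]
    [HasZeroObject T] [HasShift T ℤ] [∀ n : ℤ, (shiftFunctor T n).Additive]
    [∀ n : ℤ, (shiftFunctor T n).Linear K] [Pretriangulated T]
    (hfin : ∀ A B : T, FiniteDimensional K (DirectSum ℤ (fun k : ℤ => A ⟶ B⟦k⟧)))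
    (m : ℕ) (E E' : Fin (m + 1) → T)
    (hexc : ∀ i, IsExceptional K (E i))
    (hseq : ∀ i j : Fin (m + 1), i < j → ∀ (k : ℤ) (φ : E j ⟶ (E i)⟦k⟧), φ = 0)
    (hfull : ∀ X : T, GenSub (Set.range E) X)
    (hexc' : ∀ i, IsExceptional K (E' i))
    (hseq' : ∀ i j : Fin (m + 1), i < j → ∀ (k : ℤ) (φ : E' i ⟶ (E' j)⟦k⟧), φ = 0)
    (hfull' : ∀ X : T, GenSub (Set.range E') X)
    (hdual : ∀ (i j : Fin (m + 1)) (k : ℤ),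
      (i = j ∧ k = 0 → Module.finrank K (E i ⟶ (E' j)⟦k⟧) = 1) ∧
      (¬ (i = j ∧ k = 0) → ∀ φ : E i ⟶ (E' j)⟦k⟧, φ = 0))
    (l : Fin (m + 1)) (F : T)
    (hF : ∀ (i : Fin (m + 1)) (k : ℤ),
      (i = l ∧ k = 0 → Module.finrank K (E i ⟶ F⟦k⟧) = 1) ∧
      (¬ (i = l ∧ k = 0) → ∀ φ : E i ⟶ F⟦k⟧, φ = 0)) :
    Nonempty (F ≅ E' l) := by
  have span : ∀ {X Y : T} (f : X ⟶ Y), Module.finrank K (X ⟶ Y) = 1 → f ≠ 0 →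
      ∀ u : X ⟶ Y, ∃ c : K, u = c • f := fun f h1 hf u => by
    obtain ⟨c, hc⟩ := (finrank_eq_one_iff_of_nonzero' f hf).1 h1 u
    exact ⟨c, hc.symm⟩
  have rank0 : ∀ {X Y : T}, Module.finrank K (X ⟶ Y⟦(0 : ℤ)⟧) = 1 →
      Module.finrank K (X ⟶ Y) = 1 := fun {X Y} h => by
    rw [← h]
    exact (Linear.homCongr K (Iso.refl X) ((shiftFunctorZero T ℤ).symm.app Y)).finrank_eq
  have ex : ∀ {X Y : T}, Module.finrank K (X ⟶ Y) = 1 → ∃ f : X ⟶ Y, f ≠ 0 := fun {X Y} h => by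
    have : Nontrivial (X ⟶ Y) := Module.nontrivial_of_finrank_pos (R := K) (by omega)
    exact exists_ne 0
  have hEs : ∀ i, ∀ u : E i ⟶ E i, ∃ c : K, u = c • 𝟙 (E i) := fun i => by
    refine span _ (hexc i).1 (fun h0 => ?_)
    obtain ⟨f, hf⟩ := ex (hexc i).1
    exact hf (by rw [← Category.id_comp f, h0, zero_comp])
  have r1 := rank0 ((hdual l l 0).1 ⟨rfl, rfl⟩)
  have r2 := rank0 ((hF l 0).1 ⟨rfl, rfl⟩)
  obtain ⟨e, he⟩ := ex r1
  obtain ⟨g, hg⟩ := ex r2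
  have hE'k : ∀ k : ℤ, k ≠ 0 → ∀ u : E l ⟶ (E' l)⟦k⟧, u = 0 :=
    fun k hk => (hdual l l k).2 (fun h => hk h.2)
  have hFk : ∀ k : ℤ, k ≠ 0 → ∀ u : E l ⟶ F⟦k⟧, u = 0 :=
    fun k hk => (hF l k).2 (fun h => hk h.2)
  have hE'i : ∀ i, i ≠ l → Perp (E i) (E' l) := fun i hi k => (hdual i l k).2 (fun h => hi h.1)
  have hFi : ∀ i, i ≠ l → Perp (E i) F := fun i hi k => (hF i k).2 (fun h => hi h.1)
  obtain ⟨C, p, q, hT⟩ := distinguished_cocone_triangle e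
  have hC : ∀ i : Fin (m + 1), l.val ≤ i.val → Perp (E i) C := by
    intro i hi
    by_cases hil : i = l
    · subst hil
      refine perp3 (K := K) hT (𝟙 (E i)) (hEs i) (hexc i).2 ?_ ?_ hE'k
      · simpa using he
      · simpa using span e r1 he
    · refine Perp.tri _ hT (hseq l i ?_) (hE'i i hil)
      exact lt_of_le_of_ne hi (fun h => hil h.symm)
  have horth := orth hfin m E hEs (fun i => (hexc i).2) hseq hfull l.val (by omega)
    (C⟦(-1 : ℤ)⟧) F (fun i hi => (hC i hi).shift _)
    (fun i hi => hFi i (fun h => by rw [h] at hi; exact lt_irrefl _ hi))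
  obtain ⟨h, hh⟩ := Triangle.yoneda_exact₂ _ (inv_rot_of_distTriang _ hT) g (horth _)
  change E' l ⟶ F at h
  change g = e ≫ h at hh
  obtain ⟨D, p', q', hT'⟩ := distinguished_cocone_triangle h
  have hD : IsZero D := by
    apply isZero_of_perp hfull
    rintro _ ⟨i, rfl⟩
    by_cases hil : i = l
    · subst hil
      refine perp3 (K := K) hT' e (span e r1 he) hE'k ?_ ?_ hFk
      · change e ≫ h ≠ 0
        rwa [← hh]
      · change ∀ u : E i ⟶ F, ∃ c : K, u = c • (e ≫ h)
        rw [← hh]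
        exact span g r2 hg
    · exact Perp.tri _ hT' (hE'i i hil) (hFi i hil)
  have hiso : IsIso h := (Triangle.isZero₃_iff_isIso₁ _ hT').1 hD
  exact ⟨(asIso h).symm⟩
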